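/- Let g, d be positive integers and s ∈ [0,1]^g. The following are equivalent: (i) s ∈ Γ(g,d), i.e., for all d×d effects E_1,…,E_g the noisy effects s_i E_i + (1−s_i) I/2 are compatible; (ii) for every g-tuple (X_1,…,X_g) of d×d Hermitian matrices with −I ≤ X_i ≤ I for all i, there exist finitely many vectors z_j ∈ [−1,1]^g and positive semidefinite matrices H_j with ∑_j H_j = I and s_i X_i = ∑_j z_j(i) H_j for all i ∈ [g]. In other words, Γ(g,d) equals the matrix cube inclusion set Δ_□(g,d). -/

import Mathlib

open Matrix ComplexOrder

noncomputable section

/-- A quantum effect: `0 ≤ E ≤ I` in the Loewner order. -/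
def IsEffect {d : ℕ} (E : Matrix (Fin d) (Fin d) ℂ) : Prop :=
  E.PosSemidef ∧ ((1 : Matrix (Fin d) (Fin d) ℂ) - E).PosSemidef

/-- Effects `E i` are compatible if the dichotomic POVMs `(E i, I - E i)` are jointly measurable:
there is a joint POVM `(K ε)` indexed by sign vectors with `E i = ∑_{ε : ε i = 1} K ε`. -/
def CompatibleEffects {g d : ℕ} (E : Fin g → Matrix (Fin d) (Fin d) ℂ) : Prop :=
  ∃ K : (Fin g → Bool) → Matrix (Fin d) (Fin d) ℂ,
    (∀ ε, (K ε).PosSemidef) ∧ (∑ ε, K ε = 1) ∧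
    ∀ i, E i = ∑ ε ∈ Finset.univ.filter (fun ε : Fin g → Bool => ε i = true), K ε

/-- The compatibility region `Γ(g, d)` for dichotomic measurements. -/
def GammaD (g d : ℕ) : Set (Fin g → ℝ) :=
  {s | (∀ i, s i ∈ Set.Icc (0 : ℝ) 1) ∧
    ∀ E : Fin g → Matrix (Fin d) (Fin d) ℂ, (∀ i, IsEffect (E i)) →
      CompatibleEffects (fun i => s i • E i +
        ((1 - s i) * (2 : ℝ)⁻¹) • (1 : Matrix (Fin d) (Fin d) ℂ))}

/-- The probability of `ε` under the product of Bernoulli distributions with parameters `p i`. -/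
def bernoulliWeight {g : ℕ} (p : Fin g → ℝ) (ε : Fin g → Bool) : ℝ :=
  ∏ i, if ε i = true then p i else 1 - p i

lemma bernoulliWeight_nonneg {g : ℕ} {p : Fin g → ℝ} (hp : ∀ i, p i ∈ Set.Icc (0 : ℝ) 1)
    (ε : Fin g → Bool) : 0 ≤ bernoulliWeight p ε := by
  refine Finset.prod_nonneg fun i _ => ?_
  split_ifs
  · exact (hp i).1
  · exact sub_nonneg.2 (hp i).2

lemma sum_bernoulliWeight {g : ℕ} (p : Fin g → ℝ) : ∑ ε, bernoulliWeight p ε = 1 := by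
  have h := Finset.prod_univ_sum (fun _ : Fin g => (Finset.univ : Finset Bool))
    (fun i b => if b = true then p i else 1 - p i)
  rw [Fintype.piFinset_univ] at h
  simpa [bernoulliWeight] using h.symm

lemma sum_filter_bernoulliWeight {g : ℕ} (p : Fin g → ℝ) (i : Fin g) :
    ∑ ε ∈ Finset.univ.filter (fun ε : Fin g → Bool => ε i = true), bernoulliWeight p ε = p i := by
  have h := Finset.prod_univ_sum
    (fun k : Fin g => (Finset.univ.filter fun b : Bool => k = i → b = true))
    (fun k b => if b = true then p k else 1 - p k)
  have hs : (Fintype.piFinset fun k : Fin g =>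
      Finset.univ.filter fun b : Bool => k = i → b = true) =
      Finset.univ.filter (fun ε : Fin g → Bool => ε i = true) := by
    ext ε
    simp
  rw [hs] at h
  unfold bernoulliWeight
  rw [← h, Finset.prod_eq_single i]
  · simp [Finset.sum_filter]
  · intro k _ hk
    simp [hk]
  · simp

/-- Joint measurability through classical post-processing: effects are compatible iff they are
mixtures of a single finite POVM with weights in `[0, 1]`. -/
lemma compatibleEffects_iff_exists_postprocessing {g d : ℕ}
    (E : Fin g → Matrix (Fin d) (Fin d) ℂ) :
    CompatibleEffects E ↔
      ∃ (n : ℕ) (p : Fin n → Fin g → ℝ) (H : Fin n → Matrix (Fin d) (Fin d) ℂ),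
        (∀ j i, p j i ∈ Set.Icc (0 : ℝ) 1) ∧ (∀ j, (H j).PosSemidef) ∧ (∑ j, H j = 1) ∧
        ∀ i, E i = ∑ j, p j i • H j := by
  constructor
  · rintro ⟨K, hK, hK1, hE⟩
    let e := (Fintype.equivFin (Fin g → Bool)).symm
    refine ⟨_, fun j i => if e j i = true then 1 else 0, fun j => K (e j), fun j i => ?_,
      fun j => hK _, (e.sum_comp K).trans hK1, fun i => ?_⟩
    · dsimp only
      split_ifs <;> simp
    · rw [hE i, Finset.sum_filter,
        ← e.sum_comp (fun ε : Fin g → Bool => if ε i = true then K ε else 0)]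
      simp only [ite_smul, one_smul, zero_smul]
  · rintro ⟨n, p, H, hp, hH, hH1, hE⟩
    refine ⟨fun ε => ∑ j, bernoulliWeight (p j) ε • H j, fun ε => ?_, ?_, fun i => ?_⟩
    · exact posSemidef_sum _ fun j _ => (hH j).smul (bernoulliWeight_nonneg (hp j) ε)
    · rw [Finset.sum_comm]
      simp_rw [← Finset.sum_smul, sum_bernoulliWeight, one_smul, hH1]
    · rw [Finset.sum_comm]
      simp_rw [← Finset.sum_smul, sum_filter_bernoulliWeight, hE i]

/-- `Γ(g,d)` equals the matrix cube inclusion set `Δ_□(g,d)`. -/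
theorem gamma_eq_matrix_cube_inclusion (g d : ℕ) (hg : 0 < g) (hd : 0 < d)
    (s : Fin g → ℝ) (hs : ∀ i, s i ∈ Set.Icc (0 : ℝ) 1) :
    s ∈ GammaD g d ↔
      ∀ X : Fin g → Matrix (Fin d) (Fin d) ℂ, (∀ i, (X i).IsHermitian) →
        (∀ i, ((1 : Matrix (Fin d) (Fin d) ℂ) + X i).PosSemidef) →
        (∀ i, ((1 : Matrix (Fin d) (Fin d) ℂ) - X i).PosSemidef) →
        ∃ (n : ℕ) (z : Fin n → Fin g → ℝ) (H : Fin n → Matrix (Fin d) (Fin d) ℂ),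
          (∀ j i, |z j i| ≤ 1) ∧ (∀ j, (H j).PosSemidef) ∧ (∑ j, H j = 1) ∧
          ∀ i, s i • X i = ∑ j, z j i • H j := by
  constructor
  · rintro ⟨-, hΓ⟩ X - hX₁ hX₂
    have h2 : (0 : ℝ) ≤ 2⁻¹ := by norm_num
    obtain ⟨n, p, H, hp, hH, hH1, hE⟩ := (compatibleEffects_iff_exists_postprocessing _).1
      (hΓ (fun i => (2 : ℝ)⁻¹ • (1 + X i)) fun i => ⟨(hX₁ i).smul h2, by
        convert (hX₂ i).smul h2 using 1
        module⟩)
    refine ⟨n, fun j i => 2 * p j i - 1, H, fun j i => ?_, hH, hH1, fun i => ?_⟩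
    · rw [abs_le]
      constructor <;> linarith [(hp j i).1, (hp j i).2]
    · simp_rw [sub_smul, Finset.sum_sub_distrib, mul_smul, ← Finset.smul_sum, one_smul, hH1,
        ← hE i]
      module
  · intro h
    refine ⟨hs, fun E hE => (compatibleEffects_iff_exists_postprocessing _).2 ?_⟩
    obtain ⟨n, z, H, hz, hH, hH1, hX⟩ := h (fun i => (2 : ℝ) • E i - 1)
      (fun i => ((hE i).1.smul (zero_le_two (α := ℝ))).isHermitian.sub isHermitian_one)
      (fun i => by simpa using (hE i).1.smul (zero_le_two (α := ℝ)))
      (fun i => by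
        convert (hE i).2.smul (zero_le_two (α := ℝ)) using 1
        module)
    refine ⟨n, fun j i => (2 : ℝ)⁻¹ * (1 + z j i), H, fun j i => ?_, hH, hH1, fun i => ?_⟩
    · have := abs_le.1 (hz j i)
      constructor <;> linarith
    · simp_rw [mul_smul, ← Finset.smul_sum, add_smul, Finset.sum_add_distrib, one_smul, hH1,
        ← hX i]
      module
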